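/- arXiv:2408.08857 — 4 statements merged into one kernel-verified Lean document; each statement's English description precedes it below -/
import Mathlib

section
/- Nonzero-contribution conditions for the quadratic gadget: for every θ ∈ ℝ and every subset S ⊆ {1,2}, the permanent of the principal submatrix of A₂(θ) on the index set S ∪ {3} equals e^{iθ} if S = {1,2}, and equals 1 otherwise. In particular per(A₂(θ)) = e^{iθ}. -/
open Complex in
/-- The quadratic clause gadget `A₂(θ)`: indices `0, 1` are the outer vertices and
index `2` is the inner vertex. -/
noncomputable def A2 (θ : ℝ) : Matrix (Fin 3) (Fin 3) ℂ :=
  !![(1 + exp (θ * I)) / 2, (exp (θ * I) - 1) / 2, (1 - exp (θ * I)) / 2;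
     -1, 0, 1;
     1, 1, 1]

namespace Matrix

variable {m n R : Type*} [Fintype m] [DecidableEq m] [CommSemiring R]

theorem permanent_submatrix_equiv_self [Fintype n] [DecidableEq n] (e : m ≃ n)
    (A : Matrix n n R) : (A.submatrix e e).permanent = A.permanent := by
  refine Fintype.sum_equiv (Equiv.permCongr e) _ _ fun σ ↦ ?_
  exact Fintype.prod_equiv e _ _ fun i ↦ by simp

/-- The permanent of a principal submatrix can be computed along any injective enumeration of its
index set. -/
theorem permanent_submatrix_coe_finset [DecidableEq n] (A : Matrix n n R) (T : Finset n)
    (f : m → n) (hf : Function.Injective f) (hT : ∀ x, x ∈ T ↔ ∃ i, f i = x) :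
    (A.submatrix (fun a : {x // x ∈ T} => (a : n)) (fun a : {x // x ∈ T} => (a : n))).permanent
      = (A.submatrix f f).permanent := by
  have he : Function.Bijective (fun i ↦ (⟨f i, (hT _).2 ⟨i, rfl⟩⟩ : {x // x ∈ T})) :=
    ⟨fun i j h ↦ hf (congrArg Subtype.val h), fun x ↦
      ((hT x).1 x.2).imp fun i h ↦ Subtype.ext h⟩
  rw [← permanent_submatrix_equiv_self (Equiv.ofBijective _ he)]
  rfl

theorem permanent_fin_two (A : Matrix (Fin 2) (Fin 2) R) :
    A.permanent = A 0 0 * A 1 1 + A 0 1 * A 1 0 := by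
  simp [permanent, Finset.univ_perm_fin_succ, ← Finset.univ_product_univ, Fin.sum_univ_succ,
    Fin.prod_univ_succ]
  ring

theorem permanent_fin_three (A : Matrix (Fin 3) (Fin 3) R) :
    A.permanent = A 0 0 * (A 1 1 * A 2 2 + A 1 2 * A 2 1)
      + A 0 1 * (A 1 0 * A 2 2 + A 1 2 * A 2 0)
      + A 0 2 * (A 1 0 * A 2 1 + A 1 1 * A 2 0) := by
  have huniv : (Finset.univ : Finset (Equiv.Perm (Fin 3))) =
      {1, .swap 0 1, .swap 0 2, .swap 1 2, .swap 0 1 * .swap 1 2, .swap 1 2 * .swap 0 1} := by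
    decide
  rw [permanent, huniv]
  repeat rw [Finset.sum_insert (by decide)]
  simp [Fin.prod_univ_three, Equiv.swap_apply_def]
  ring

end Matrix

theorem A2_permanent (θ : ℝ) : (A2 θ).permanent = Complex.exp (θ * Complex.I) := by
  rw [Matrix.permanent_fin_three]
  simp [A2]
  ring

/-- Nonzero-contribution conditions for the quadratic gadget: for every subset `S` of the
outer vertices `{0, 1}`, the permanent of the principal submatrix of `A₂(θ)` on `S ∪ {2}`
is `e^{iθ}` if `S = {0, 1}` and `1` otherwise; in particular `per (A₂(θ)) = e^{iθ}`. -/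
theorem A2_nonzero_contributions (θ : ℝ) (S : Finset (Fin 3)) (hS : S ⊆ {0, 1}) :
    (((A2 θ).submatrix
        (fun a : {x // x ∈ S ∪ ({2} : Finset (Fin 3))} => (a : Fin 3))
        (fun a : {x // x ∈ S ∪ ({2} : Finset (Fin 3))} => (a : Fin 3))).permanent
      = if S = {0, 1} then Complex.exp (θ * Complex.I) else 1) ∧
    (A2 θ).permanent = Complex.exp (θ * Complex.I) := by
  refine ⟨?_, A2_permanent θ⟩
  have hcases : S = ∅ ∨ S = {0} ∨ S = {1} ∨ S = {0, 1} := by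
    revert S
    decide
  rcases hcases with rfl | rfl | rfl | rfl
  · rw [Matrix.permanent_submatrix_coe_finset _ _ ![2] (by decide) (by decide),
      if_neg (by decide), Matrix.permanent_unique]
    simp [A2]
  · rw [Matrix.permanent_submatrix_coe_finset _ _ ![0, 2] (by decide) (by decide),
      if_neg (by decide), Matrix.permanent_fin_two]
    simp [A2]
    ring
  · rw [Matrix.permanent_submatrix_coe_finset _ _ ![1, 2] (by decide) (by decide),
      if_neg (by decide), Matrix.permanent_fin_two]
    simp [A2]
  · rw [Matrix.permanent_submatrix_coe_finset _ _ id Function.injective_id (by decide),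
      if_pos rfl, Matrix.submatrix_id_id, A2_permanent]
end

section
/- For every natural number q ≥ 77, ∑_{x=0}^{q} ∑_{y=0}^{C(q,2)} ∑_{z=0}^{t(q,C(q,2),q)−1} C(q,x)·C(C(q,2),y)·C(C(q,3),z) ≤ 2^{q + C(q,2) + C(q,3)·H((t(q,C(q,2),q)−1)/C(q,3))}, where t(x,y,q) := ⌈5.68x + 12.14y + 3.07q⌉ and C(n,k) denotes the binomial coefficient (with C(n,k) = 0 for k > n). -/
/-- The binary entropy function `H(u) = −u·log₂ u − (1−u)·log₂(1−u)`
(with the conventions `H(0) = H(1) = 0`, using `Real.logb 2 0 = 0`). -/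
noncomputable def binaryEntropy (u : ℝ) : ℝ :=
  -u * Real.logb 2 u - (1 - u) * Real.logb 2 (1 - u)

/-- The threshold `t(x, y, q) = ⌈5.68x + 12.14y + 3.07q⌉` of Lemma 3, as a natural number. -/
noncomputable def thr (x y q : ℕ) : ℕ :=
  (⌈(5.68 * (x : ℝ) + 12.14 * (y : ℝ) + 3.07 * (q : ℝ))⌉).toNat

/-- Chernoff-type bound on an initial segment of a row of Pascal's triangle. -/
lemma sum_range_choose_mul_pow_le (n k : ℕ) (p : ℝ) (hp : 0 ≤ p) (hp2 : p ≤ 1 / 2)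
    (hkn : k ≤ n) :
    (∑ z ∈ Finset.range (k + 1), (n.choose z : ℝ)) * (p ^ k * (1 - p) ^ (n - k)) ≤ 1 := by
  calc (∑ z ∈ Finset.range (k + 1), (n.choose z : ℝ)) * (p ^ k * (1 - p) ^ (n - k))
      ≤ ∑ z ∈ Finset.range (k + 1), p ^ z * (1 - p) ^ (n - z) * (n.choose z : ℝ) := by
        rw [Finset.sum_mul]
        refine Finset.sum_le_sum fun z hz => ?_
        have hzk : z ≤ k := Nat.lt_succ_iff.mp (Finset.mem_range.mp hz)
        rw [mul_comm]
        refine mul_le_mul_of_nonneg_right ?_ (Nat.cast_nonneg _)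
        have h1 : p ^ k = p ^ z * p ^ (k - z) := by rw [← pow_add]; congr 1; omega
        have h2 : (1 - p) ^ (n - z) = (1 - p) ^ (k - z) * (1 - p) ^ (n - k) := by
          rw [← pow_add]; congr 1; omega
        have h3 : p ^ (k - z) ≤ (1 - p) ^ (k - z) := pow_le_pow_left₀ hp (by linarith) _
        have h4 : 0 ≤ 1 - p := by linarith
        rw [h1, h2, mul_assoc]
        gcongr
    _ ≤ ∑ z ∈ Finset.range (n + 1), p ^ z * (1 - p) ^ (n - z) * (n.choose z : ℝ) := by
        have h4 : 0 ≤ 1 - p := by linarith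
        exact Finset.sum_le_sum_of_subset_of_nonneg
          (Finset.range_mono (by omega)) fun _ _ _ => by positivity
    _ = 1 := by rw [← add_pow]; simp

lemma two_rpow_mul_binaryEntropy (n k : ℕ) (hk : 0 < k) (hkn : k < n) :
    (2 : ℝ) ^ ((n : ℝ) * binaryEntropy ((k : ℝ) / n)) =
      (((k : ℝ) / n) ^ k * (1 - (k : ℝ) / n) ^ (n - k))⁻¹ := by
  have hn : (0 : ℝ) < n := by exact_mod_cast hk.trans hkn
  have hp : 0 < (k : ℝ) / n := by positivity
  have hp1 : 0 < 1 - (k : ℝ) / n := by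
    rw [sub_pos, div_lt_one hn]; exact_mod_cast hkn
  have hexp : (n : ℝ) * binaryEntropy ((k : ℝ) / n) =
      -(Real.logb 2 ((k : ℝ) / n) * k + Real.logb 2 (1 - (k : ℝ) / n) * (n - k : ℕ)) := by
    rw [binaryEntropy, Nat.cast_sub hkn.le]
    field_simp
    ring
  rw [hexp, Real.rpow_neg two_pos.le, Real.rpow_add two_pos, Real.rpow_mul two_pos.le,
    Real.rpow_mul two_pos.le, Real.rpow_logb two_pos (by norm_num) hp,
    Real.rpow_logb two_pos (by norm_num) hp1, Real.rpow_natCast, Real.rpow_natCast]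

/-- The entropy bound for initial segments of binomial coefficients up to the middle. -/
lemma sum_range_choose_le_two_rpow (n k : ℕ) (hk : 0 < k) (hkn : 2 * k ≤ n) :
    (∑ z ∈ Finset.range (k + 1), (n.choose z : ℝ)) ≤
      (2 : ℝ) ^ ((n : ℝ) * binaryEntropy ((k : ℝ) / n)) := by
  have hn : (0 : ℝ) < n := by exact_mod_cast (by omega : 0 < n)
  have hp2 : (k : ℝ) / n ≤ 1 / 2 := by
    rw [div_le_div_iff₀ hn two_pos]
    exact_mod_cast (by omega : k * 2 ≤ 1 * n)
  have hp1 : 0 < 1 - (k : ℝ) / n := by linarith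
  rw [two_rpow_mul_binaryEntropy n k hk (by omega), ← one_div, le_div_iff₀ (by positivity)]
  exact sum_range_choose_mul_pow_le n k _ (by positivity) hp2 (by omega)

lemma cast_choose_three (q : ℕ) :
    ((q.choose 3 : ℕ) : ℝ) = (q : ℝ) * (q - 1) * (q - 2) / 6 := by
  rw [Nat.cast_choose_eq_descPochhammer_div]
  simp [descPochhammer_succ_left, Nat.factorial]
  ring

/-- From `77` qubits on, the threshold stays below half of the number of possible CCZ gates. -/
lemma thr_sub_one_bounds (q : ℕ) (hq : 77 ≤ q) :
    ∃ k, thr q (q.choose 2) q = k + 1 ∧ 0 < k ∧ 2 * k ≤ q.choose 3 := by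
  have hqr : (77 : ℝ) ≤ q := by exact_mod_cast hq
  set v : ℝ := 5.68 * (q : ℝ) + 12.14 * (q.choose 2 : ℝ) + 3.07 * (q : ℝ) with hv
  have hv1 : 1 < v := by
    have : (0 : ℝ) ≤ q.choose 2 := Nat.cast_nonneg _
    rw [hv]; linarith
  have ht : thr q (q.choose 2) q = ⌈v⌉₊ := rfl
  have hlt : 1 < ⌈v⌉₊ := Nat.lt_ceil.mpr (by exact_mod_cast hv1)
  refine ⟨⌈v⌉₊ - 1, by omega, by omega, ?_⟩
  have hkv : ((⌈v⌉₊ - 1 : ℕ) : ℝ) < v := Nat.lt_ceil.mp (by omega)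
  have hmid : 2 * v ≤ (q.choose 3 : ℝ) := by
    rw [hv, Nat.cast_choose_two, cast_choose_three]
    nlinarith [mul_nonneg (by linarith : (0 : ℝ) ≤ q)
      (by nlinarith : (0 : ℝ) ≤ (q - 1) * (q - 2) - 72.84 * (q - 1) - 105)]
  exact_mod_cast (by linarith : 2 * ((⌈v⌉₊ - 1 : ℕ) : ℝ) ≤ (q.choose 3 : ℝ))

/-- Entropy bound on the number of `q`-qubit IQP circuits violating the CCZ-count condition:
for `q ≥ 77`,
`∑_{x=0}^{q} ∑_{y=0}^{C(q,2)} ∑_{z=0}^{t(q,C(q,2),q)−1} C(q,x)·C(C(q,2),y)·C(C(q,3),z)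
  ≤ 2^{q + C(q,2) + C(q,3)·H((t(q,C(q,2),q)−1)/C(q,3))}`. -/
theorem card_complement_Sq_le (q : ℕ) (hq : 77 ≤ q) :
    ((∑ x ∈ Finset.range (q + 1), ∑ y ∈ Finset.range (q.choose 2 + 1),
        ∑ z ∈ Finset.range (thr q (q.choose 2) q),
          q.choose x * (q.choose 2).choose y * (q.choose 3).choose z : ℕ) : ℝ)
      ≤ (2 : ℝ) ^ ((q : ℝ) + (q.choose 2 : ℝ) + (q.choose 3 : ℝ) *
          binaryEntropy (((thr q (q.choose 2) q : ℝ) - 1) / (q.choose 3 : ℝ))) := by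
  obtain ⟨k, ht, hk, hkn⟩ := thr_sub_one_bounds q hq
  have hsum : (∑ x ∈ Finset.range (q + 1), ∑ y ∈ Finset.range (q.choose 2 + 1),
      ∑ z ∈ Finset.range (k + 1), q.choose x * (q.choose 2).choose y * (q.choose 3).choose z) =
      2 ^ q * 2 ^ q.choose 2 * ∑ z ∈ Finset.range (k + 1), (q.choose 3).choose z := by
    simp_rw [← Finset.mul_sum, ← Finset.sum_mul, ← Finset.mul_sum, ← Finset.sum_mul,
      Nat.sum_range_choose]
  rw [ht, hsum, Real.rpow_add two_pos, Real.rpow_add two_pos, Real.rpow_natCast,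
    Real.rpow_natCast]
  push_cast
  rw [add_sub_cancel_right]
  gcongr
  exact sum_range_choose_le_two_rpow _ k hk hkn
end

section
/- Theorem (size of S_q, combinatorial form): with t(x,y,q) := ⌈5.68x + 12.14y + 3.07q⌉, the ratio (∑_{x=0}^{q} ∑_{y=0}^{C(q,2)} ∑_{z=0}^{t(x,y,q)−1} C(q,x)·C(C(q,2),y)·C(C(q,3),z)) / 2^{q + C(q,2) + C(q,3)} tends to 0 as q → ∞. Equivalently, the fraction of q-qubit IQP circuits C with α(C) < 1 tends to 1 as q → ∞. -/
theorem thr_le {x y q : ℕ} (hx : x ≤ q) (hy : y ≤ q.choose 2) : thr x y q ≤ 16 * q ^ 2 := by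
  have hxr : (x : ℝ) ≤ q := by exact_mod_cast hx
  have hyr : (y : ℝ) ≤ q * (q - 1) / 2 := by
    rw [← Nat.cast_choose_two ℝ q]
    exact_mod_cast hy
  rw [thr, Int.toNat_le, Int.ceil_le]
  push_cast
  have hq : (q : ℝ) ≤ (q : ℝ) ^ 2 := by exact_mod_cast Nat.le_self_pow two_ne_zero q
  nlinarith

/-- A Chernoff bound for the lower tail of the binomial coefficients. -/
theorem two_pow_mul_sum_range_choose_le (n t : ℕ) :
    2 ^ n * ∑ z ∈ Finset.range t, n.choose z ≤ 2 ^ t * 3 ^ n := by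
  have h3 : ∑ z ∈ Finset.range (n + 1), 2 ^ (n - z) * n.choose z = 3 ^ n := by
    simpa using (add_pow (1 : ℕ) 2 n).symm
  have hsub : ∑ z ∈ Finset.range t, 2 ^ (n - z) * n.choose z ≤ 3 ^ n := by
    rw [← h3]
    refine Finset.sum_le_sum_of_ne_zero fun z _ hz => ?_
    rw [Finset.mem_range, Nat.lt_succ_iff]
    by_contra! h
    exact hz (by rw [Nat.choose_eq_zero_of_lt h, mul_zero])
  refine le_trans ?_ (Nat.mul_le_mul_left (2 ^ t) hsub)
  rw [Finset.mul_sum, Finset.mul_sum]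
  refine Finset.sum_le_sum fun z hz => ?_
  rw [Finset.mem_range] at hz
  rw [← mul_assoc, ← pow_add]
  gcongr
  · norm_num
  · lia

theorem two_pow_mul_sum_range_choose_le_two_pow {n t q : ℕ} (h : 3 * (t + q) ≤ n) :
    2 ^ q * ∑ z ∈ Finset.range t, n.choose z ≤ 2 ^ n := by
  have key : 2 ^ q * (2 ^ t * 3 ^ n) ≤ 2 ^ n * 2 ^ n := by
    obtain ⟨r, rfl⟩ := Nat.exists_eq_add_of_le h
    calc 2 ^ q * (2 ^ t * 3 ^ (3 * (t + q) + r)) = 54 ^ (t + q) * 3 ^ r := by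
          rw [pow_add 3, pow_mul, ← mul_assoc, ← mul_assoc, ← pow_add, add_comm q t, ← mul_pow]
          norm_num
      _ ≤ 64 ^ (t + q) * 4 ^ r := by gcongr <;> norm_num
      _ = 2 ^ (3 * (t + q) + r) * 2 ^ (3 * (t + q) + r) := by
          rw [← mul_pow, pow_add (2 * 2), pow_mul (2 * 2)]
          norm_num
  refine Nat.le_of_mul_le_mul_left (?_ : 2 ^ n * _ ≤ 2 ^ n * _) (by positivity)
  calc 2 ^ n * (2 ^ q * ∑ z ∈ Finset.range t, n.choose z)
      = 2 ^ q * (2 ^ n * ∑ z ∈ Finset.range t, n.choose z) := by ring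
    _ ≤ 2 ^ q * (2 ^ t * 3 ^ n) := Nat.mul_le_mul_left _ (two_pow_mul_sum_range_choose_le n t)
    _ ≤ 2 ^ n * 2 ^ n := key

theorem three_mul_le_choose_three {q : ℕ} (hq : 400 ≤ q) :
    3 * (16 * q ^ 2 + q) ≤ q.choose 3 := by
  obtain ⟨k, rfl⟩ := Nat.exists_eq_add_of_le hq
  have h := Nat.descFactorial_eq_factorial_mul_choose (400 + k) 3
  have h1 : 400 + k - 2 = 398 + k := by lia
  have h2 : 400 + k - 1 = 399 + k := by lia
  simp only [Nat.descFactorial_succ, Nat.descFactorial_zero, h1, h2, Nat.sub_zero,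
    Nat.factorial, mul_one] at h
  nlinarith [Nat.zero_le (k ^ 3), Nat.zero_le (k ^ 2)]

theorem sum_choose_mul_two_pow_le {q : ℕ} (hq : 400 ≤ q) :
    (∑ x ∈ Finset.range (q + 1), ∑ y ∈ Finset.range (q.choose 2 + 1),
        ∑ z ∈ Finset.range (thr x y q),
          q.choose x * (q.choose 2).choose y * (q.choose 3).choose z) * 2 ^ q
      ≤ 2 ^ (q + q.choose 2 + q.choose 3) := by
  set S := ∑ z ∈ Finset.range (16 * q ^ 2), (q.choose 3).choose z
  have hsum : ∑ x ∈ Finset.range (q + 1), ∑ y ∈ Finset.range (q.choose 2 + 1),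
      ∑ z ∈ Finset.range (thr x y q),
        q.choose x * (q.choose 2).choose y * (q.choose 3).choose z
      ≤ 2 ^ q * 2 ^ q.choose 2 * S := by
    rw [← Nat.sum_range_choose q, ← Nat.sum_range_choose (q.choose 2), Finset.sum_mul_sum,
      Finset.sum_mul]
    refine Finset.sum_le_sum fun x hx => ?_
    rw [Finset.sum_mul]
    refine Finset.sum_le_sum fun y hy => ?_
    rw [← Finset.mul_sum]
    refine Nat.mul_le_mul_left _ (Finset.sum_le_sum_of_subset ?_)
    exact Finset.range_subset_range.2
      (thr_le (Finset.mem_range_succ_iff.1 hx) (Finset.mem_range_succ_iff.1 hy))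
  calc _ ≤ 2 ^ q * 2 ^ q.choose 2 * S * 2 ^ q := Nat.mul_le_mul_right _ hsum
    _ = 2 ^ q * 2 ^ q.choose 2 * (2 ^ q * S) := by ring
    _ ≤ 2 ^ q * 2 ^ q.choose 2 * 2 ^ q.choose 3 := Nat.mul_le_mul_left _
        (two_pow_mul_sum_range_choose_le_two_pow (three_mul_le_choose_three hq))
    _ = _ := by rw [pow_add, pow_add]

/-- Size of `S_q` (combinatorial form): the fraction of `q`-qubit IQP circuits whose number
`z` of CCZ gates satisfies `z < t(x, y, q)` (i.e. with `α(C) ≥ 1`) tends to `0` as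
`q → ∞`; equivalently, the fraction with `α(C) < 1` tends to `1`. -/
theorem fraction_alpha_ge_one_tendsto_zero :
    Filter.Tendsto (fun q : ℕ =>
      ((∑ x ∈ Finset.range (q + 1), ∑ y ∈ Finset.range (q.choose 2 + 1),
          ∑ z ∈ Finset.range (thr x y q),
            q.choose x * (q.choose 2).choose y * (q.choose 3).choose z : ℕ) : ℝ)
        / 2 ^ (q + q.choose 2 + q.choose 3))
      Filter.atTop (nhds 0) := by
  refine squeeze_zero' (.of_forall fun q => by positivity) ?_
    (tendsto_pow_atTop_nhds_zero_of_lt_one (r := (1 / 2 : ℝ)) (by norm_num) (by norm_num))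
  filter_upwards [Filter.eventually_ge_atTop 400] with q hq
  rw [one_div_pow, div_le_div_iff₀ (by positivity) (by positivity), one_mul]
  exact_mod_cast sum_choose_mul_two_pow_le hq
end

section
/- Theorem (size of P_q, combinatorial form): the ratio (∑_{x=0}^{q} ∑_{y=0}^{C(q,2)} ∑_{z=0}^{x+y−1} C(q,x)·C(C(q,2),y)·C(C(q,3),z)) / 2^{q + C(q,2) + C(q,3)} tends to 0 as q → ∞. Equivalently, the fraction of q-qubit IQP circuits for which the graph-encoding technique requires fewer photons per shot than the KLM scheme (i.e., with #(CCZ) ≥ #(Z) + #(CZ)) tends to 1 as q → ∞. -/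
/-- A Chernoff-type bound for the lower binomial tail. -/
theorem sum_range_choose_le_two_pow_mul {m n : ℕ} (hmn : m ≤ n) :
    (∑ z ∈ Finset.range m, (n.choose z : ℝ)) ≤ 2 ^ m * (3 / 2) ^ n := by
  calc (∑ z ∈ Finset.range m, (n.choose z : ℝ))
      ≤ ∑ z ∈ Finset.range m, 2 ^ m * ((1 / 2 : ℝ) ^ z * n.choose z) := by
        refine Finset.sum_le_sum fun z hz => ?_
        have h : (1 : ℝ) ≤ 2 ^ m * (1 / 2) ^ z := by
          rw [one_div, inv_pow, ← div_eq_mul_inv, one_le_div (by positivity)]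
          exact pow_le_pow_right₀ one_le_two (Finset.mem_range.mp hz).le
        rw [← mul_assoc]
        exact le_mul_of_one_le_left (Nat.cast_nonneg _) h
    _ = 2 ^ m * ∑ z ∈ Finset.range m, (1 / 2 : ℝ) ^ z * n.choose z := by
        rw [Finset.mul_sum]
    _ ≤ 2 ^ m * ∑ z ∈ Finset.range (n + 1), (1 / 2 : ℝ) ^ z * n.choose z := by
        gcongr
        omega
    _ = 2 ^ m * (3 / 2) ^ n := by
        have h := add_pow (1 / 2 : ℝ) 1 n
        norm_num at h ⊢
        exact h.symm

theorem three_mul_choose_two_add_le_choose_three {q : ℕ} (hq : 14 ≤ q) :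
    3 * (q + q.choose 2) ≤ q.choose 3 := by
  suffices 3 * (q + q.choose 2) ≤ q.choose 3 ∧ 3 * (q + 1) ≤ q.choose 2 from this.1
  induction q, hq using Nat.le_induction with
  | base => decide
  | succ q hq ih =>
    have h₃ : (q + 1).choose 3 = q.choose 2 + q.choose 3 := Nat.choose_succ_succ q 2
    have h₂ : (q + 1).choose 2 = q + q.choose 2 := by
      rw [Nat.choose_succ_succ' q 1, Nat.choose_one_right]
    omega

theorem sum_choose_mul_choose_mul_choose_le (a b n : ℕ) :
    (∑ x ∈ Finset.range (a + 1), ∑ y ∈ Finset.range (b + 1), ∑ z ∈ Finset.range (x + y),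
      a.choose x * b.choose y * n.choose z)
      ≤ 2 ^ (a + b) * ∑ z ∈ Finset.range (a + b), n.choose z := by
  calc _ ≤ ∑ x ∈ Finset.range (a + 1), ∑ y ∈ Finset.range (b + 1),
        a.choose x * b.choose y * ∑ z ∈ Finset.range (a + b), n.choose z := by
        refine Finset.sum_le_sum fun x hx => Finset.sum_le_sum fun y hy => ?_
        rw [← Finset.mul_sum]
        rw [Finset.mem_range] at hx hy
        gcongr <;> omega
    _ = 2 ^ (a + b) * ∑ z ∈ Finset.range (a + b), n.choose z := by
        simp_rw [← Finset.sum_mul, ← Finset.mul_sum, Nat.sum_range_choose, ← Finset.sum_mul,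
          Nat.sum_range_choose, pow_add]

/-- Size of `P_q` (combinatorial form): the fraction of `q`-qubit IQP circuits whose gate
counts satisfy `#CCZ < #Z + #CZ` (i.e. those for which the graph encoding needs more
photons per shot than KLM) tends to `0` as `q → ∞`; equivalently, the fraction for which
the graph-encoding technique requires fewer photons per shot tends to `1`. -/
theorem fraction_more_photons_tendsto_zero :
    Filter.Tendsto (fun q : ℕ =>
      ((∑ x ∈ Finset.range (q + 1), ∑ y ∈ Finset.range (q.choose 2 + 1),
          ∑ z ∈ Finset.range (x + y),
            q.choose x * (q.choose 2).choose y * (q.choose 3).choose z : ℕ) : ℝ)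
        / 2 ^ (q + q.choose 2 + q.choose 3))
      Filter.atTop (nhds 0) := by
  refine tendsto_of_tendsto_of_tendsto_of_le_of_le' tendsto_const_nhds
    (tendsto_pow_atTop_nhds_zero_of_lt_one (r := (27 / 32 : ℝ)) (by norm_num) (by norm_num))
    (Filter.Eventually.of_forall fun q => by positivity) ?_
  filter_upwards [Filter.eventually_ge_atTop 14] with q hq
  have hn := three_mul_choose_two_add_le_choose_three hq
  have hsum : ((∑ x ∈ Finset.range (q + 1), ∑ y ∈ Finset.range (q.choose 2 + 1),
      ∑ z ∈ Finset.range (x + y),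
        q.choose x * (q.choose 2).choose y * (q.choose 3).choose z : ℕ) : ℝ) ≤
      2 ^ (q + q.choose 2) * ∑ z ∈ Finset.range (q + q.choose 2), ((q.choose 3).choose z : ℝ) :=
    mod_cast sum_choose_mul_choose_mul_choose_le q (q.choose 2) (q.choose 3)
  have hm : q ≤ q + q.choose 2 := Nat.le_add_right _ _
  generalize q + q.choose 2 = m at hn hsum hm ⊢
  generalize q.choose 3 = n at hn hsum ⊢
  rw [div_le_iff₀ (by positivity)]
  calc _ ≤ (2 : ℝ) ^ m * (2 ^ m * (3 / 2) ^ n) :=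
        hsum.trans (by gcongr; exact sum_range_choose_le_two_pow_mul (by omega))
    _ = 2 ^ m * (3 / 4) ^ n * 2 ^ (m + n) := by
        rw [show (3 / 2 : ℝ) = 3 / 4 * 2 by norm_num, mul_pow, pow_add]
        ring
    _ ≤ 2 ^ m * (3 / 4) ^ (3 * m) * 2 ^ (m + n) := by
        gcongr _ * ?_ * _
        exact pow_le_pow_of_le_one (by norm_num) (by norm_num) hn
    _ = (27 / 32) ^ m * 2 ^ (m + n) := by
        rw [pow_mul, ← mul_pow]
        norm_num
    _ ≤ (27 / 32) ^ q * 2 ^ (m + n) := by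
        gcongr ?_ * _
        exact pow_le_pow_of_le_one (by norm_num) (by norm_num) hm
end
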